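/- Let μ, ν, ρ be finite nonempty sets and consider functions f_a : μ × ρ → Fin 2, f_b : Fin 2 × ν → Fin 2, f_c : Fin 2 × μ → Fin 2, f_d : Fin 2 × ν × ρ → Fin 2 (the Evans structure: a ← (μ, ρ), b ← (a, ν), c ← (b, μ), d ← (c, ν, ρ)). Define the observed quadruple for (m, n, r) as (a, b, c, d) with a = f_a(m, r), b = f_b(a, n), c = f_c(b, m), d = f_d(c, n, r). Then for any y ∈ Fin 2, the image of the observation map over μ × ν × ρ cannot equal {(0,0,0,y), (1,0,1,0), (0,1,1,1)}. -/

import Mathlib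

/-- For any `y`, the support `{(0,0,0,y),(1,0,1,0),(0,1,1,1)}` is
possibilistically incompatible with the Evans causal structure. -/
theorem evans_incompatible
    {μ ν ρ : Type*} [Fintype μ] [Fintype ν] [Fintype ρ]
    [Nonempty μ] [Nonempty ν] [Nonempty ρ]
    (f_a : μ × ρ → Fin 2) (f_b : Fin 2 × ν → Fin 2)
    (f_c : Fin 2 × μ → Fin 2) (f_d : Fin 2 × ν × ρ → Fin 2)
    (y : Fin 2) :
    Set.range (fun t : μ × ν × ρ =>
        (f_a (t.1, t.2.2),
         f_b (f_a (t.1, t.2.2), t.2.1),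
         f_c (f_b (f_a (t.1, t.2.2), t.2.1), t.1),
         f_d (f_c (f_b (f_a (t.1, t.2.2), t.2.1), t.1), t.2.1, t.2.2)))
      ≠ ({((0 : Fin 2), (0 : Fin 2), (0 : Fin 2), y), (1, 0, 1, 0), (0, 1, 1, 1)} :
          Set (Fin 2 × Fin 2 × Fin 2 × Fin 2)) := by
  intro h
  have h1 := h.ge (show ((0 : Fin 2), (0 : Fin 2), (0 : Fin 2), y) ∈ _ by simp)
  have h2 := h.ge (show ((1 : Fin 2), (0 : Fin 2), (1 : Fin 2), (0 : Fin 2)) ∈ _ by simp)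
  have h3 := h.ge (show ((0 : Fin 2), (1 : Fin 2), (1 : Fin 2), (1 : Fin 2)) ∈ _ by simp)
  obtain ⟨⟨m1, n1, r1⟩, e1⟩ := h1
  obtain ⟨⟨m2, n2, r2⟩, e2⟩ := h2
  obtain ⟨⟨m3, n3, r3⟩, e3⟩ := h3
  have k1 := h.le (Set.mem_range_self (m2, n3, r3))
  have k2 := h.le (Set.mem_range_self (m2, n1, r3))
  simp only [Prod.mk.injEq, Set.mem_insert_iff, Set.mem_singleton_iff] at e1 e2 e3 k1 k2
  obtain ⟨a1, b1, c1, d1⟩ := e1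
  obtain ⟨a2, b2, c2, d2⟩ := e2
  obtain ⟨a3, b3, c3, d3⟩ := e3
  rw [b1] at c1
  rw [a1] at b1
  rw [b2] at c2
  rw [c3] at d3
  rw [a3] at b3
  have ha : f_a (m2, r3) = 0 ∨ f_a (m2, r3) = 1 := by omega
  rcases ha with ha | ha
  · rw [ha, b1, c2] at k2
    simp at k2
  · simp only [ha] at k1
    rcases k1 with k | ⟨-, -, kc, kd⟩ | k
    · simp at k
    · rw [kc, d3] at kd
      simp at kd
    · simp at k
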